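/- arXiv:1312.4550 — 3 statements merged into one kernel-verified Lean document; each statement's English description precedes it below -/
import Mathlib

section
/- Let P > 1 be a real number, let d ≥ 1, R ∈ ℕ, let u : ℤ^d → ℝ be harmonic on the ball B_{⌈P²R⌉} (i.e. (Δu)(x) = 0 for all x with ‖x‖₁ ≤ ⌈P²R⌉ − 1), and let 0 ≤ ε ≤ 0.5. Then for every natural number n with 4P² ≤ n ≤ R, Q_u(⌊Pn⌋) ≤ √( e^{n^{−2ε}} · Q_u(n) · Q_u(⌈P²n⌉) ) + P^{−n^{0.5−ε}} · Q_u(⌈P²n⌉), where Q_u(m) = (A^m(u²))(0) and ⌊·⌋, ⌈·⌉ are floor and ceiling. -/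
/-- The standard generators of `ℤ^d`: `±e_i`, indexed by `Fin d × Bool`. -/
def latticeGen (d : ℕ) (s : Fin d × Bool) : Fin d → ℤ :=
  fun j => if s.1 = j then (if s.2 then 1 else -1) else 0

/-- The averaging operator `(A f)(x) = (1/(2d)) ∑_{s ∈ S} f(x+s)`. -/
noncomputable def latticeAvg (d : ℕ) (f : (Fin d → ℤ) → ℝ) : (Fin d → ℤ) → ℝ :=
  fun x => (1 / (2 * (d : ℝ))) * ∑ s : Fin d × Bool, f (x + latticeGen d s)

/-- The discrete Laplacian `Δf = Af − f`. -/
noncomputable def latticeLap (d : ℕ) (f : (Fin d → ℤ) → ℝ) : (Fin d → ℤ) → ℝ :=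
  fun x => latticeAvg d f x - f x

/-- The growth function `Q_u(n) = (Aⁿ (u²))(0)`. -/
noncomputable def growthQ (d : ℕ) (u : (Fin d → ℤ) → ℝ) (n : ℕ) : ℝ :=
  (latticeAvg d)^[n] (fun y => (u y) ^ 2) 0

/-- Forward difference of a function on `ℕ`. -/
def fdiff (g : ℕ → ℝ) : ℕ → ℝ := fun n => g (n + 1) - g n

/-- The discrete Laplacian as a linear endomorphism. -/
noncomputable def latticeLapEnd (d : ℕ) : Module.End ℝ ((Fin d → ℤ) → ℝ) where
  toFun := latticeLap d
  map_add' f g := by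
    ext x
    simp only [latticeLap, latticeAvg, Pi.add_apply, Finset.sum_add_distrib]
    ring
  map_smul' c f := by
    ext x
    simp only [latticeLap, latticeAvg, Pi.smul_apply, smul_eq_mul, RingHom.id_apply,
      ← Finset.mul_sum]
    ring

lemma latticeLapEnd_apply (d : ℕ) (f : (Fin d → ℤ) → ℝ) (x : Fin d → ℤ) :
    latticeLapEnd d f x = latticeLap d f x := rfl

lemma latticeAvg_iterate_eq (d n : ℕ) (f : (Fin d → ℤ) → ℝ) :
    (latticeAvg d)^[n] f = ((latticeLapEnd d + 1) ^ n) f := by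
  have h : latticeAvg d = ⇑(latticeLapEnd d + 1) := by
    ext g x
    simp [latticeLapEnd_apply, latticeLap]
  rw [Module.End.pow_apply, h]

/-- Newton expansion of the growth function. -/
lemma growthQ_eq_sum_choose (d : ℕ) (u : (Fin d → ℤ) → ℝ) {n M : ℕ} (hnM : n ≤ M) :
    growthQ d u n = ∑ k ∈ Finset.range (M + 1),
      (n.choose k : ℝ) * ((latticeLapEnd d ^ k) fun y => u y ^ 2) 0 := by
  have h : growthQ d u n = ∑ k ∈ Finset.range (n + 1),
      (n.choose k : ℝ) * ((latticeLapEnd d ^ k) fun y => u y ^ 2) 0 := by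
    rw [growthQ, latticeAvg_iterate_eq, (Commute.one_right _).add_pow, LinearMap.sum_apply,
      Finset.sum_apply]
    refine Finset.sum_congr rfl fun k _ => ?_
    rw [one_pow, mul_one, ← nsmul_eq_mul', LinearMap.smul_apply, Pi.smul_apply, nsmul_eq_mul]
  rw [h]
  refine Finset.sum_subset (by intro k; simp; omega) fun k _ hk => ?_
  rw [Nat.choose_eq_zero_of_lt (by simpa using hk)]
  simp

lemma sum_abs_add_latticeGen_le (d : ℕ) (x : Fin d → ℤ) (s : Fin d × Bool) :
    ∑ i, |(x + latticeGen d s) i| ≤ (∑ i, |x i|) + 1 := by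
  have h : ∑ i, |latticeGen d s i| = 1 := by
    rw [Finset.sum_eq_single s.1 (fun j _ hj => by simp [latticeGen, hj.symm]) (by simp)]
    rcases s.2.eq_false_or_eq_true with hs | hs <;> simp [latticeGen, hs]
  calc ∑ i, |(x + latticeGen d s) i| ≤ ∑ i, (|x i| + |latticeGen d s i|) :=
        Finset.sum_le_sum fun i _ => abs_add_le _ _
    _ = _ := by rw [Finset.sum_add_distrib, h]

/-- Values of `Δᵏ f` on a ball depend only on `f` on the ball of radius larger by `k`. -/
lemma latticeLapEnd_pow_congr (d k : ℕ) : ∀ (r : ℤ) (f g : (Fin d → ℤ) → ℝ),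
    (∀ y, ∑ i, |y i| ≤ r + k → f y = g y) → ∀ x, ∑ i, |x i| ≤ r →
      (latticeLapEnd d ^ k) f x = (latticeLapEnd d ^ k) g x := by
  induction k with
  | zero => intro r f g h x hx; simpa using h x (by simpa using hx)
  | succ k ih =>
    intro r f g h x hx
    rw [pow_succ, Module.End.mul_apply, Module.End.mul_apply]
    refine ih r _ _ (fun y hy => ?_) x hx
    simp only [latticeLapEnd_apply, latticeLap, latticeAvg]
    rw [h y (by push_cast; linarith)]
    congr 2
    refine Finset.sum_congr rfl fun s _ => h _ ?_
    have := sum_abs_add_latticeGen_le d y s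
    push_cast
    linarith

lemma latticeLap_sq_of_harmonicAt {d : ℕ} (hd : 1 ≤ d) (u : (Fin d → ℤ) → ℝ) (x : Fin d → ℤ)
    (hx : latticeLap d u x = 0) :
    latticeLap d (fun y => u y ^ 2) x =
      (1 / (2 * (d : ℝ))) * ∑ s : Fin d × Bool, (u (x + latticeGen d s) - u x) ^ 2 := by
  have hd' : (d : ℝ) ≠ 0 := by positivity
  have hsum : ∑ s : Fin d × Bool, (u (x + latticeGen d s) - u x) ^ 2 =
      ∑ s : Fin d × Bool, u (x + latticeGen d s) ^ 2
        - 2 * u x * ∑ s : Fin d × Bool, u (x + latticeGen d s) + 2 * d * u x ^ 2 := by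
    simp only [sub_sq, Finset.sum_add_distrib, Finset.sum_sub_distrib, Finset.mul_sum]
    simp only [Finset.sum_const, Finset.card_univ, Fintype.card_prod, Fintype.card_fin,
      Fintype.card_bool, nsmul_eq_mul]
    push_cast
    congr 1
    · congr 1
      exact Finset.sum_congr rfl fun s _ => by ring
    · ring
  simp only [latticeLap, latticeAvg] at hx ⊢
  rw [hsum]
  set S := ∑ s : Fin d × Bool, u (x + latticeGen d s)
  have hS : S = 2 * d * u x := by
    field_simp at hx
    linarith
  rw [hS]
  field_simp
  ring

/-- Absolute monotonicity: `Δᵏ(u²) ≥ 0` where `u` is harmonic nearby. -/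
lemma latticeLapEnd_pow_sq_nonneg {d : ℕ} (hd : 1 ≤ d) (k : ℕ) :
    ∀ (r : ℤ) (u : (Fin d → ℤ) → ℝ), (∀ y, ∑ i, |y i| ≤ r + k - 1 → latticeLap d u y = 0) →
      ∀ x, ∑ i, |x i| ≤ r → 0 ≤ (latticeLapEnd d ^ k) (fun y => u y ^ 2) x := by
  induction k with
  | zero => intro r u _ x _; simpa using sq_nonneg (u x)
  | succ k ih =>
    intro r u hu x hx
    let v : Fin d × Bool → (Fin d → ℤ) → ℝ := fun s y => u (y + latticeGen d s) - u y
    rw [pow_succ, Module.End.mul_apply,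
      latticeLapEnd_pow_congr d k r (latticeLapEnd d fun y => u y ^ 2)
        ((1 / (2 * (d : ℝ))) • ∑ s : Fin d × Bool, fun y => v s y ^ 2) (fun y hy => ?_) x hx,
      map_smul, map_sum, Pi.smul_apply, Finset.sum_apply, smul_eq_mul]
    · refine mul_nonneg (by positivity) (Finset.sum_nonneg fun s _ =>
        ih r (v s) (fun y hy => ?_) x hx)
      have h1 := hu y (by push_cast; linarith)
      have h2 := hu (y + latticeGen d s) (by
        have := sum_abs_add_latticeGen_le d y s
        push_cast
        linarith)
      have h3 : latticeLap d (v s) y =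
          latticeLap d u (y + latticeGen d s) - latticeLap d u y := by
        simp only [v, latticeLap, latticeAvg, Finset.sum_sub_distrib, add_right_comm y]
        ring
      rw [h3, h1, h2, sub_zero]
    · rw [latticeLapEnd_apply,
        latticeLap_sq_of_harmonicAt hd u y (hu y (by push_cast; linarith))]
      simp [v]

lemma choose_succ_mul_eq_mul_sub (m k : ℕ) :
    (m.choose (k + 1) : ℝ) * (k + 1) = m.choose k * ((m : ℝ) - k) := by
  rcases le_or_gt k m with h | h
  · have := Nat.choose_succ_right_eq m k
    rw [← Nat.cast_sub h]
    exact_mod_cast this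
  · rw [Nat.choose_eq_zero_of_lt h, Nat.choose_eq_zero_of_lt (by omega)]
    simp

lemma pow_mul_choose_le_choose {P : ℝ} (hP : 1 ≤ P) {m M : ℕ} (h : P * m ≤ M) (k : ℕ) :
    P ^ k * m.choose k ≤ M.choose k := by
  induction k with
  | zero => simp
  | succ k ih =>
    rcases le_or_gt m k with hk | hk
    · rw [Nat.choose_eq_zero_of_lt (by omega)]
      simp
    · have hk' : (k : ℝ) < m := by exact_mod_cast hk
      have hk0 : (0 : ℝ) < k + 1 := by positivity
      refine le_of_mul_le_mul_right ?_ hk0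
      calc P ^ (k + 1) * (m.choose (k + 1) : ℝ) * (k + 1)
          = P ^ (k + 1) * ((m.choose (k + 1) : ℝ) * (k + 1)) := by ring
        _ = (P ^ k * m.choose k) * (P * (m - k)) := by rw [choose_succ_mul_eq_mul_sub]; ring
        _ ≤ M.choose k * ((M : ℝ) - k) :=
          mul_le_mul ih (by nlinarith) (mul_nonneg (by linarith) (by linarith)) (by positivity)
        _ = _ := (choose_succ_mul_eq_mul_sub M k).symm

lemma sub_sq_le_exp_mul {P : ℝ} (hP : 1 ≤ P) {n m M k : ℝ} (hk : 0 ≤ k) (hkn : (k + 1) ^ 2 ≤ n)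
    (hnm : n ≤ m) (hm : m ≤ P * n) (hM : P ^ 2 * n ≤ M) :
    (m - k) ^ 2 ≤ Real.exp ((2 * k + 1) / n) * ((n - k) * (M - k)) := by
  have hn : 0 < n := by nlinarith
  have hkn' : k ≤ n := by nlinarith
  have hP2 : 1 ≤ P ^ 2 := by nlinarith
  have h1 : P ^ 2 * (n - k) ≤ P ^ 2 * n - k := by nlinarith
  have h2 : n ^ 2 ≤ 2 * (n - k) ^ 2 := by
    have : 0 ≤ n - 4 * k := by nlinarith [sq_nonneg (k - 1)]
    nlinarith [mul_nonneg hn.le this, sq_nonneg k]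
  have h3 : (P - 1) ^ 2 * n ^ 2 ≤ 2 * ((n - k) * (P ^ 2 * n - k)) :=
    calc (P - 1) ^ 2 * n ^ 2 ≤ P ^ 2 * n ^ 2 :=
          mul_le_mul_of_nonneg_right (by nlinarith) (sq_nonneg n)
      _ ≤ P ^ 2 * (2 * (n - k) ^ 2) := mul_le_mul_of_nonneg_left h2 (by positivity)
      _ = 2 * ((n - k) * (P ^ 2 * (n - k))) := by ring
      _ ≤ _ := by gcongr
  have h4 : 0 ≤ (n - k) * (P ^ 2 * n - k) := by
    nlinarith [mul_nonneg (sq_nonneg (P - 1)) (sq_nonneg n)]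
  calc (m - k) ^ 2 ≤ (P * n - k) ^ 2 := by
        apply pow_le_pow_left₀ <;> linarith
    _ = (n - k) * (P ^ 2 * n - k) + k / n * ((P - 1) ^ 2 * n ^ 2) := by field_simp; ring
    _ ≤ (n - k) * (P ^ 2 * n - k) + k / n * (2 * ((n - k) * (P ^ 2 * n - k))) := by gcongr
    _ = (2 * k / n + 1) * ((n - k) * (P ^ 2 * n - k)) := by ring
    _ ≤ Real.exp ((2 * k + 1) / n) * ((n - k) * (P ^ 2 * n - k)) := by
        refine mul_le_mul_of_nonneg_right ((Real.add_one_le_exp _).trans ?_) h4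
        gcongr
        linarith
    _ ≤ _ := by
        gcongr

lemma choose_sq_le_exp_mul_choose_mul_choose {P : ℝ} (hP : 1 ≤ P) {n m M : ℕ} (hnm : n ≤ m)
    (hm : (m : ℝ) ≤ P * n) (hM : P ^ 2 * n ≤ M) (k : ℕ) (hk : k ^ 2 ≤ n) :
    (m.choose k : ℝ) ^ 2 ≤ Real.exp ((k : ℝ) ^ 2 / n) * (n.choose k * M.choose k) := by
  induction k with
  | zero => simp
  | succ k ih =>
    have ih' := ih (le_trans (Nat.pow_le_pow_left k.le_succ 2) hk)
    have hk' : ((k : ℝ) + 1) ^ 2 ≤ n := by exact_mod_cast hk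
    have hk0 : (0 : ℝ) < ((k : ℝ) + 1) ^ 2 := by positivity
    have step := sub_sq_le_exp_mul hP k.cast_nonneg hk' (by exact_mod_cast hnm) hm hM
    refine le_of_mul_le_mul_right ?_ hk0
    calc (m.choose (k + 1) : ℝ) ^ 2 * ((k : ℝ) + 1) ^ 2
        = ((m.choose (k + 1) : ℝ) * (k + 1)) ^ 2 := by ring
      _ = (m.choose k : ℝ) ^ 2 * ((m : ℝ) - k) ^ 2 := by rw [choose_succ_mul_eq_mul_sub]; ring
      _ ≤ (Real.exp ((k : ℝ) ^ 2 / n) * (n.choose k * M.choose k)) *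
          (Real.exp ((2 * k + 1) / n) * (((n : ℝ) - k) * (M - k))) :=
        mul_le_mul ih' step (sq_nonneg _) (by positivity)
      _ = Real.exp ((k : ℝ) ^ 2 / n + (2 * k + 1) / n) *
          ((n.choose k * ((n : ℝ) - k)) * (M.choose k * ((M : ℝ) - k))) := by
        rw [Real.exp_add]; ring
      _ = _ := by
        rw [← choose_succ_mul_eq_mul_sub, ← choose_succ_mul_eq_mul_sub, ← add_div]
        push_cast
        ring_nf

/-- Three-term inequality for nonnegative combinations of binomial coefficients. -/
lemma sum_choose_mul_le {P : ℝ} (hP : 1 < P) {n m M : ℕ} (hn : 1 ≤ n) (hnm : n ≤ m)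
    (hm : (m : ℝ) ≤ P * n) (hM : P ^ 2 * n ≤ M) {ε : ℝ} (hε : 0 ≤ ε) (s : Finset ℕ) (a : ℕ → ℝ)
    (ha : ∀ k ∈ s, 0 ≤ a k) :
    ∑ k ∈ s, (m.choose k : ℝ) * a k ≤
      Real.sqrt (Real.exp ((n : ℝ) ^ (-(2 * ε))) * (∑ k ∈ s, (n.choose k : ℝ) * a k)
          * ∑ k ∈ s, (M.choose k : ℝ) * a k)
        + P ^ (-((n : ℝ) ^ ((0.5 : ℝ) - ε))) * ∑ k ∈ s, (M.choose k : ℝ) * a k := by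
  have hn0 : (0 : ℝ) < n := by exact_mod_cast hn
  have hP0 : 0 < P := by linarith
  set E := Real.exp ((n : ℝ) ^ (-(2 * ε)))
  have hE : 0 ≤ E := (Real.exp_pos _).le
  have hnn : ∀ j : ℕ, ∀ k ∈ s, 0 ≤ (j.choose k : ℝ) * a k := fun j k hk =>
    mul_nonneg (by positivity) (ha k hk)
  have key : ∀ k ∈ s, (m.choose k : ℝ) * a k ≤
      Real.sqrt (E * (n.choose k * a k)) * Real.sqrt (M.choose k * a k)
        + P ^ (-((n : ℝ) ^ ((0.5 : ℝ) - ε))) * (M.choose k * a k) := by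
    intro k hk
    have hak := ha k hk
    rcases lt_or_ge (k : ℝ) ((n : ℝ) ^ ((0.5 : ℝ) - ε)) with hlt | hge
    · have hk2 : (k : ℝ) ^ 2 ≤ n * (n : ℝ) ^ (-(2 * ε)) := by
        calc (k : ℝ) ^ 2 ≤ ((n : ℝ) ^ ((0.5 : ℝ) - ε)) ^ 2 := by gcongr
          _ = (n : ℝ) ^ (1 + -(2 * ε)) := by
            rw [← Real.rpow_natCast, ← Real.rpow_mul hn0.le]
            norm_num
            ring_nf
          _ = _ := by rw [Real.rpow_add hn0, Real.rpow_one]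
      have hle1 : (n : ℝ) ^ (-(2 * ε)) ≤ 1 :=
        Real.rpow_le_one_of_one_le_of_nonpos (by exact_mod_cast hn) (by linarith)
      have hkn : k ^ 2 ≤ n := by
        have : (k : ℝ) ^ 2 ≤ n := by nlinarith
        exact_mod_cast this
      have hc := choose_sq_le_exp_mul_choose_mul_choose hP.le hnm hm hM k hkn
      have hexp : Real.exp ((k : ℝ) ^ 2 / n) ≤ E := by
        apply Real.exp_le_exp.mpr
        rw [div_le_iff₀ hn0]
        linarith
      have hle : (m.choose k : ℝ) * a k ≤
          Real.sqrt (E * (n.choose k * a k)) * Real.sqrt (M.choose k * a k) := by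
        rw [← Real.sqrt_mul (mul_nonneg hE (hnn n k hk))]
        apply Real.le_sqrt_of_sq_le
        calc ((m.choose k : ℝ) * a k) ^ 2 = (m.choose k : ℝ) ^ 2 * a k ^ 2 := by ring
          _ ≤ (E * (n.choose k * M.choose k)) * a k ^ 2 := by
            gcongr
            exact hc.trans (by gcongr)
          _ = _ := by ring
      have := mul_nonneg (Real.rpow_nonneg hP0.le (-((n : ℝ) ^ ((0.5 : ℝ) - ε)))) (hnn M k hk)
      linarith
    · have hc := pow_mul_choose_le_choose hP.le (m := m) (M := M) (by nlinarith) k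
      have hrp : P ^ (-(k : ℝ)) ≤ P ^ (-((n : ℝ) ^ ((0.5 : ℝ) - ε))) :=
        Real.rpow_le_rpow_of_exponent_le hP.le (by linarith)
      have h1 : (m.choose k : ℝ) ≤ P ^ (-(k : ℝ)) * M.choose k := by
        rw [Real.rpow_neg hP0.le, Real.rpow_natCast, ← div_eq_inv_mul,
          le_div_iff₀ (by positivity)]
        linarith
      have h2 : (m.choose k : ℝ) * a k ≤
          P ^ (-((n : ℝ) ^ ((0.5 : ℝ) - ε))) * (M.choose k * a k) := by
        rw [← mul_assoc]
        exact mul_le_mul_of_nonneg_right (h1.trans (by gcongr)) hak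
      have : 0 ≤ Real.sqrt (E * (n.choose k * a k)) * Real.sqrt (M.choose k * a k) := by positivity
      linarith
  calc ∑ k ∈ s, (m.choose k : ℝ) * a k
      ≤ ∑ k ∈ s, (Real.sqrt (E * (n.choose k * a k)) * Real.sqrt (M.choose k * a k)
        + P ^ (-((n : ℝ) ^ ((0.5 : ℝ) - ε))) * (M.choose k * a k)) := Finset.sum_le_sum key
    _ = ∑ k ∈ s, Real.sqrt (E * (n.choose k * a k)) * Real.sqrt (M.choose k * a k)
        + P ^ (-((n : ℝ) ^ ((0.5 : ℝ) - ε))) * ∑ k ∈ s, (M.choose k * a k) := by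
      rw [Finset.sum_add_distrib, Finset.mul_sum]
    _ ≤ _ := by
      gcongr
      refine (Real.sum_mul_le_sqrt_mul_sqrt s _ _).trans_eq ?_
      rw [Finset.sum_congr rfl fun k hk => Real.sq_sqrt (mul_nonneg hE (hnn n k hk)),
        Finset.sum_congr rfl fun k hk => Real.sq_sqrt (hnn M k hk), ← Finset.mul_sum,
        ← Real.sqrt_mul (mul_nonneg hE (Finset.sum_nonneg (hnn n)))]

theorem stmt_14 (P : ℝ) (hP : 1 < P) (d : ℕ) (hd : 1 ≤ d) (R : ℕ)
    (u : (Fin d → ℤ) → ℝ)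
    (hu : ∀ x : Fin d → ℤ, (∑ i, |x i|) ≤ (⌈P ^ 2 * (R : ℝ)⌉₊ : ℤ) - 1 → latticeLap d u x = 0)
    (ε : ℝ) (hε0 : 0 ≤ ε) (hε1 : ε ≤ 0.5) :
    ∀ n : ℕ, 4 * P ^ 2 ≤ (n : ℝ) → n ≤ R →
      growthQ d u ⌊P * (n : ℝ)⌋₊ ≤
        Real.sqrt (Real.exp ((n : ℝ) ^ (-(2 * ε))) * growthQ d u n
            * growthQ d u ⌈P ^ 2 * (n : ℝ)⌉₊)
          + P ^ (-((n : ℝ) ^ ((0.5 : ℝ) - ε))) * growthQ d u ⌈P ^ 2 * (n : ℝ)⌉₊ := by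
  intro n hn hnR
  have hP2 : 1 < P ^ 2 := by nlinarith
  have hn1 : 1 ≤ n := by
    have : (1 : ℝ) ≤ n := by linarith
    exact_mod_cast this
  have hn0 : (0 : ℝ) ≤ n := n.cast_nonneg
  have hnm : n ≤ ⌊P * (n : ℝ)⌋₊ := Nat.le_floor (by nlinarith)
  have hm : (⌊P * (n : ℝ)⌋₊ : ℝ) ≤ P * n := Nat.floor_le (by positivity)
  have hM : P ^ 2 * n ≤ (⌈P ^ 2 * (n : ℝ)⌉₊ : ℝ) := Nat.le_ceil _
  have hmM : ⌊P * (n : ℝ)⌋₊ ≤ ⌈P ^ 2 * (n : ℝ)⌉₊ := by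
    have : (⌊P * (n : ℝ)⌋₊ : ℝ) ≤ ⌈P ^ 2 * (n : ℝ)⌉₊ :=
      hm.trans (le_trans (mul_le_mul_of_nonneg_right (by nlinarith) hn0) hM)
    exact_mod_cast this
  have hMR : ⌈P ^ 2 * (n : ℝ)⌉₊ ≤ ⌈P ^ 2 * (R : ℝ)⌉₊ := by gcongr
  rw [growthQ_eq_sum_choose d u hmM, growthQ_eq_sum_choose d u (hnm.trans hmM),
    growthQ_eq_sum_choose d u le_rfl]
  refine sum_choose_mul_le hP hn1 hnm hm hM hε0 _ _ fun k hk => ?_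
  refine latticeLapEnd_pow_sq_nonneg hd k 0 u (fun y hy => hu y ?_) 0 (by simp)
  have : k ≤ ⌈P ^ 2 * (n : ℝ)⌉₊ := by simpa [Nat.lt_succ_iff] using hk
  omega
end

section
/- For every C > 0 and every ε > 0 there exists k₀ ∈ ℕ such that for every natural number k > k₀, setting n = ⌊k²/log k⌋ (natural logarithm), the binomial coefficients satisfy C(2n,k) > C · √( C(n,k) · C(4n,k) ) + 2^{−n^{0.5+ε}} · C(4n,k), where C(m,k) denotes the binomial coefficient m choose k and n^{0.5+ε} is a real power of the real number n. -/
/-- A quantitative log-concavity bound for `m ↦ m.choose k` along `n, 2 * n, 4 * n`. -/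
theorem choose_mul_choose_four_mul_le {n k : ℕ} (hn : 0 < n) (hk : k ≤ n) :
    (1 + (k : ℝ) * (k - 1) / (8 * n)) * ((n.choose k : ℝ) * ((4 * n).choose k : ℝ)) ≤
      ((2 * n).choose k : ℝ) ^ 2 := by
  have key : ∀ j : ℕ, j ≤ n → (1 + (j : ℝ) * (j - 1) / (8 * n)) *
      ((n.descFactorial j : ℝ) * ((4 * n).descFactorial j : ℝ)) ≤
        ((2 * n).descFactorial j : ℝ) ^ 2 := by
    intro j
    induction j with
    | zero => simp
    | succ j ih =>
      intro hj
      have ih := ih (by omega)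
      have hn' : (0 : ℝ) < n := by exact_mod_cast hn
      have hjn : (j : ℝ) + 1 ≤ n := by exact_mod_cast hj
      have hj0 : (0 : ℝ) ≤ j := j.cast_nonneg
      rw [Nat.descFactorial_succ, Nat.descFactorial_succ, Nat.descFactorial_succ]
      push_cast [Nat.cast_sub (show j ≤ n by omega), Nat.cast_sub (show j ≤ 4 * n by omega),
        Nat.cast_sub (show j ≤ 2 * n by omega)]
      have hP : (0 : ℝ) ≤ (n.descFactorial j : ℝ) * ((4 * n).descFactorial j : ℝ) := by positivity
      generalize hPd : (n.descFactorial j : ℝ) * ((4 * n).descFactorial j : ℝ) = P at ih hP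
      generalize ((2 * n).descFactorial j : ℝ) = D at ih ⊢
      have hj1 : (0 : ℝ) ≤ (j : ℝ) * (j - 1) := by
        rcases Nat.eq_zero_or_pos j with h | h
        · simp [h]
        · have : (1 : ℝ) ≤ j := by exact_mod_cast h
          exact mul_nonneg hj0 (by linarith)
      have hS : 1 + ((j : ℝ) + 1) * (j + 1 - 1) / (8 * n) ≤
          (1 + (j : ℝ) * (j - 1) / (8 * n)) * (1 + j / (4 * n)) := by
        have h0 : 0 ≤ (j : ℝ) * (j - 1) / (8 * n) * (j / (4 * n)) := by positivity
        have h1 : ((j : ℝ) + 1) * (j + 1 - 1) / (8 * n) =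
            (j : ℝ) * (j - 1) / (8 * n) + j / (4 * n) := by
          field_simp
          ring
        rw [h1]
        linarith
      have hF : (1 + (j : ℝ) / (4 * n)) * ((n - j) * (4 * n - j)) ≤ (2 * n - j) ^ 2 := by
        have h1 : (1 + (j : ℝ) / (4 * n)) * ((n - j) * (4 * n - j)) =
            (2 * n - j) ^ 2 - j ^ 2 * (5 * n - j) / (4 * n) := by
          field_simp
          ring
        have h2 : 0 ≤ (j : ℝ) ^ 2 * (5 * n - j) / (4 * n) :=
          div_nonneg (mul_nonneg (by positivity) (by linarith)) (by positivity)
        linarith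
      have hQ : (0 : ℝ) ≤ (n - j) * (4 * n - j) := mul_nonneg (by linarith) (by linarith)
      calc _ = (1 + ((j : ℝ) + 1) * (j + 1 - 1) / (8 * n)) * (((n - j) * (4 * n - j)) * P) := by
            rw [← hPd]; ring
        _ ≤ ((1 + (j : ℝ) * (j - 1) / (8 * n)) * (1 + j / (4 * n))) *
              (((n - j) * (4 * n - j)) * P) := by gcongr
        _ = ((1 + (j : ℝ) / (4 * n)) * ((n - j) * (4 * n - j))) *
              ((1 + (j : ℝ) * (j - 1) / (8 * n)) * P) := by ring
        _ ≤ (2 * n - j) ^ 2 * D ^ 2 := by gcongr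
        _ = _ := by ring
  have h := key k hk
  simp only [Nat.descFactorial_eq_factorial_mul_choose, Nat.cast_mul] at h
  have hf : (0 : ℝ) < (k.factorial : ℝ) ^ 2 := by positivity
  refine le_of_mul_le_mul_left ?_ hf
  linarith

theorem choose_four_mul_le {n k : ℕ} (hk : k ≤ n) :
    (4 * n).choose k ≤ 4 ^ k * (2 * n).choose k := by
  have key : ∀ j : ℕ, j ≤ n →
      (4 * n).descFactorial j ≤ 4 ^ j * (2 * n).descFactorial j := by
    intro j
    induction j with
    | zero => simp
    | succ j ih =>
      intro hj
      rw [Nat.descFactorial_succ, Nat.descFactorial_succ]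
      calc _ ≤ (4 * (2 * n - j)) * (4 ^ j * (2 * n).descFactorial j) :=
            Nat.mul_le_mul (by omega) (ih (by omega))
        _ = _ := by ring
  have h := key k hk
  simp only [Nat.descFactorial_eq_factorial_mul_choose] at h
  refine Nat.le_of_mul_le_mul_left ?_ k.factorial_pos
  linarith

theorem eventually_rpow_le_floor_sq_div_log {δ : ℝ} (hδ : 0 < δ) (hδ1 : δ ≤ 1) :
    ∀ᶠ k : ℕ in Filter.atTop,
      (k : ℝ) ^ (2 - 2 * δ) ≤ (⌊(k : ℝ) ^ 2 / Real.log k⌋₊ : ℝ) := by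
  have hlog := tendsto_natCast_atTop_atTop.eventually
    ((isLittleO_log_rpow_atTop hδ).bound one_pos)
  have hpow := ((tendsto_rpow_atTop hδ).comp
    (tendsto_natCast_atTop_atTop (R := ℝ))).eventually_ge_atTop 2
  filter_upwards [hlog, hpow, Filter.eventually_ge_atTop 2] with k hl hp hk
  have hk1 : (1 : ℝ) < k := by exact_mod_cast hk
  have hk0 : (0 : ℝ) < k := by linarith
  have hlogpos : 0 < Real.log k := Real.log_pos hk1
  simp only [Function.comp_apply] at hp
  rw [one_mul, Real.norm_of_nonneg hlogpos.le, Real.norm_of_nonneg (by positivity)] at hl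
  have ha : (k : ℝ) ^ (2 - 2 * δ) * (k : ℝ) ^ δ ≤ (k : ℝ) ^ 2 / Real.log k := by
    rw [le_div_iff₀ hlogpos]
    calc _ ≤ (k : ℝ) ^ (2 - 2 * δ) * (k : ℝ) ^ δ * (k : ℝ) ^ δ := by gcongr
      _ = (k : ℝ) ^ 2 := by
        rw [← Real.rpow_add hk0, ← Real.rpow_add hk0, ← Real.rpow_natCast]
        congr 1
        push_cast
        ring
  have hb : 1 ≤ (k : ℝ) ^ (2 - 2 * δ) := Real.one_le_rpow hk1.le (by linarith)
  have hc := Nat.lt_floor_add_one ((k : ℝ) ^ 2 / Real.log k)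
  nlinarith

theorem stmt_17 (C : ℝ) (hC : 0 < C) (ε : ℝ) (hε : 0 < ε) :
    ∃ k₀ : ℕ, ∀ k : ℕ, k₀ < k → ∀ n : ℕ, n = ⌊(k : ℝ) ^ 2 / Real.log k⌋₊ →
      ((2 * n).choose k : ℝ) >
        C * Real.sqrt ((n.choose k : ℝ) * ((4 * n).choose k : ℝ))
          + (2 : ℝ) ^ (-((n : ℝ) ^ ((0.5 : ℝ) + ε))) * ((4 * n).choose k : ℝ) := by
  set δ : ℝ := ε / (1 + 2 * ε) with hδ
  have hδ0 : 0 < δ := by positivity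
  have hδ1 : δ < 1 / 2 := by
    rw [hδ, div_lt_div_iff₀ (by positivity) (by norm_num)]
    linarith
  have hexp : (2 - 2 * δ) * (0.5 + ε) = 1 + ε := by
    rw [hδ]
    field_simp
    ring
  have hpow := ((tendsto_rpow_atTop hε).comp
    (tendsto_natCast_atTop_atTop (R := ℝ))).eventually_ge_atTop 3
  have hlog := (Real.tendsto_log_atTop.comp
    (tendsto_natCast_atTop_atTop (R := ℝ))).eventually_ge_atTop (64 * C ^ 2)
  obtain ⟨k₀, hk₀⟩ := Filter.eventually_atTop.1
    ((eventually_rpow_le_floor_sq_div_log hδ0 (by linarith)).and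
      (hpow.and (hlog.and (Filter.eventually_ge_atTop 2))))
  refine ⟨k₀, fun k hk n hn => ?_⟩
  obtain ⟨hfl, hp, hl, hk2⟩ := hk₀ k hk.le
  simp only [Function.comp_apply] at hp hl
  rw [← hn] at hfl
  have hk2' : (2 : ℝ) ≤ k := by exact_mod_cast hk2
  have hk0 : (0 : ℝ) < k := by linarith
  have hlogpos : 0 < Real.log k := Real.log_pos (by linarith)
  have hkn' : (k : ℝ) ≤ n := by
    refine le_trans ?_ hfl
    conv_lhs => rw [← Real.rpow_one (k : ℝ)]
    exact Real.rpow_le_rpow_of_exponent_le (by linarith) (by linarith)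
  have hkn : k ≤ n := by exact_mod_cast hkn'
  have hn0 : 0 < n := by omega
  have hn0' : (0 : ℝ) < n := by linarith
  have hA := choose_mul_choose_four_mul_le hn0 hkn
  have hB : ((4 * n).choose k : ℝ) ≤ 4 ^ k * ((2 * n).choose k : ℝ) := by
    exact_mod_cast choose_four_mul_le hkn
  have hDpos : (0 : ℝ) < ((2 * n).choose k : ℝ) := by
    exact_mod_cast Nat.choose_pos (by omega)
  have hPpos : (0 : ℝ) < (n.choose k : ℝ) * ((4 * n).choose k : ℝ) := by
    have h1 := Nat.choose_pos hkn
    have h2 := Nat.choose_pos (show k ≤ 4 * n by omega)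
    positivity
  have hS : 4 * C ^ 2 < 1 + (k : ℝ) * (k - 1) / (8 * n) := by
    have hnle : (n : ℝ) * Real.log k ≤ (k : ℝ) ^ 2 := by
      rw [← le_div_iff₀ hlogpos, hn]
      exact Nat.floor_le (by positivity)
    have h1 : 4 * C ^ 2 ≤ (k : ℝ) * (k - 1) / (8 * n) := by
      rw [le_div_iff₀ (by positivity)]
      have h2 := mul_le_mul_of_nonneg_left hl hn0'.le
      nlinarith
    linarith
  have hfirst : C * Real.sqrt ((n.choose k : ℝ) * ((4 * n).choose k : ℝ)) <
      ((2 * n).choose k : ℝ) / 2 := by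
    refine lt_of_pow_lt_pow_left₀ 2 (by positivity) ?_
    rw [mul_pow, Real.sq_sqrt hPpos.le]
    have := mul_lt_mul_of_pos_right hS hPpos
    nlinarith
  have hsecond : (2 : ℝ) ^ (-((n : ℝ) ^ ((0.5 : ℝ) + ε))) * ((4 * n).choose k : ℝ) ≤
      ((2 * n).choose k : ℝ) / 2 := by
    have h1 : (2 * k + 1 : ℝ) ≤ (n : ℝ) ^ ((0.5 : ℝ) + ε) := by
      calc (2 * k + 1 : ℝ) ≤ (k : ℝ) * (k : ℝ) ^ ε := by nlinarith
        _ = ((k : ℝ) ^ (2 - 2 * δ)) ^ ((0.5 : ℝ) + ε) := by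
          rw [← Real.rpow_mul hk0.le, hexp, Real.rpow_add hk0, Real.rpow_one]
        _ ≤ _ := by gcongr
    have h2 : (2 : ℝ) ^ (-((n : ℝ) ^ ((0.5 : ℝ) + ε))) ≤ (4 ^ k * 2)⁻¹ := by
      calc _ ≤ (2 : ℝ) ^ (-(2 * k + 1 : ℝ)) :=
            Real.rpow_le_rpow_of_exponent_le (by norm_num) (by linarith)
        _ = _ := by
          rw [Real.rpow_neg (by norm_num), Real.rpow_add_one (by norm_num),
            Real.rpow_mul (by norm_num), Real.rpow_natCast]
          norm_num
    calc _ ≤ (4 ^ k * 2)⁻¹ * (4 ^ k * ((2 * n).choose k : ℝ)) := by gcongr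
      _ = _ := by
        field_simp
  linarith
end

section
/- Let d ≥ 1 and 0 ≤ k ≤ d. Define u_k : ℤ^d → ℝ by u_k(x_1, …, x_d) = x_1 x_2 ⋯ x_k (the product of the first k coordinates; u_0 ≡ 1). Then u_k is harmonic on ℤ^d, and its growth function satisfies Q_{u_k}(n) = (k!/d^k) · C(n,k) for every n ∈ ℕ, where C(n,k) is the binomial coefficient. -/
/-- The averaging operator applied to a product of one-variable functions over a set of
coordinates. -/
theorem latticeAvg_prod {d : ℕ} (hd : 1 ≤ d) (g : ℤ → ℝ) (I : Finset (Fin d))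
    (x : Fin d → ℤ) :
    latticeAvg d (fun y => ∏ i ∈ I, g (y i)) x = (∏ i ∈ I, g (x i)) +
      1 / (2 * (d : ℝ)) *
        ∑ i ∈ I, (g (x i + 1) + g (x i - 1) - 2 * g (x i)) * ∏ j ∈ I.erase i, g (x j) := by
  have hd0 : (d : ℝ) ≠ 0 := by positivity
  have shift : ∀ (i : Fin d) (b : Bool),
      ∏ j ∈ I, g ((x + latticeGen d (i, b)) j) = (∏ j ∈ I, g (x j)) +
        if i ∈ I then (g (x i + if b then 1 else -1) - g (x i)) * ∏ j ∈ I.erase i, g (x j)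
        else 0 := by
    intro i b
    have off : ∀ j, i ≠ j → (x + latticeGen d (i, b)) j = x j := by
      intro j hij
      simp [latticeGen, hij]
    by_cases hi : i ∈ I
    · rw [if_pos hi, ← Finset.mul_prod_erase I _ hi,
        ← Finset.mul_prod_erase I (fun j => g (x j)) hi,
        Finset.prod_congr rfl fun j hj => by rw [off j (Finset.ne_of_mem_erase hj).symm]]
      simp only [latticeGen, Pi.add_apply, if_true]
      ring
    · rw [if_neg hi, add_zero]
      exact Finset.prod_congr rfl fun j hj => by
        rw [off j (by rintro rfl; exact hi hj)]
  have pair : ∀ i : Fin d, ∑ b : Bool, ∏ j ∈ I, g ((x + latticeGen d (i, b)) j) =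
      2 * (∏ j ∈ I, g (x j)) + if i ∈ I then
        (g (x i + 1) + g (x i - 1) - 2 * g (x i)) * ∏ j ∈ I.erase i, g (x j) else 0 := by
    intro i
    rw [Fintype.sum_bool, shift, shift]
    simp only [if_true, Bool.false_eq_true, if_false, ← sub_eq_add_neg]
    split_ifs <;> ring
  unfold latticeAvg
  rw [Fintype.sum_prod_type, Finset.sum_congr rfl fun i _ => pair i, Finset.sum_add_distrib,
    Finset.sum_ite_mem, Finset.univ_inter, Finset.sum_const, Finset.card_univ, Fintype.card_fin,
    nsmul_eq_mul]
  field_simp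

/-- A product of distinct coordinates is harmonic. -/
theorem latticeLap_prod_coord {d : ℕ} (hd : 1 ≤ d) (I : Finset (Fin d)) (x : Fin d → ℤ) :
    latticeLap d (fun y => ∏ i ∈ I, (y i : ℝ)) x = 0 := by
  have h := latticeAvg_prod hd (fun m : ℤ => (m : ℝ)) I x
  rw [latticeLap, h, add_sub_cancel_left, Finset.sum_eq_zero, mul_zero]
  intro i _
  push_cast
  ring

theorem latticeAvg_prod_sq {d : ℕ} (hd : 1 ≤ d) (I : Finset (Fin d)) :
    latticeAvg d (fun y => ∏ i ∈ I, (y i : ℝ) ^ 2) =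
      (fun y => ∏ i ∈ I, (y i : ℝ) ^ 2) +
        (1 / (d : ℝ)) • ∑ i ∈ I, fun y : Fin d → ℤ => ∏ j ∈ I.erase i, (y j : ℝ) ^ 2 := by
  have hd0 : (d : ℝ) ≠ 0 := by positivity
  ext x
  rw [latticeAvg_prod hd (fun m : ℤ => (m : ℝ) ^ 2) I x]
  simp only [Pi.add_apply, Pi.smul_apply, Finset.sum_apply, smul_eq_mul, Finset.mul_sum]
  congr 1
  refine Finset.sum_congr rfl fun i _ => ?_
  push_cast
  field_simp
  ring

/-- The averaging operator as a linear map. -/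
noncomputable def latticeAvgLin (d : ℕ) : ((Fin d → ℤ) → ℝ) →ₗ[ℝ] ((Fin d → ℤ) → ℝ) where
  toFun := latticeAvg d
  map_add' f g := by
    ext x
    simp [latticeAvg, Finset.sum_add_distrib, mul_add]
  map_smul' c f := by
    ext x
    simp only [latticeAvg, Pi.smul_apply, smul_eq_mul, ← Finset.mul_sum, RingHom.id_apply]
    ring

theorem latticeAvg_iterate (d n : ℕ) (f : (Fin d → ℤ) → ℝ) :
    (latticeAvg d)^[n] f = (latticeAvgLin d ^ n) f := by
  rw [Module.End.pow_apply]
  rfl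

theorem latticeAvg_iterate_prod_sq {d : ℕ} (hd : 1 ≤ d) (n : ℕ) (I : Finset (Fin d)) :
    (latticeAvg d)^[n] (fun y => ∏ i ∈ I, (y i : ℝ) ^ 2) 0 =
      (I.card.factorial : ℝ) / (d : ℝ) ^ I.card * (n.choose I.card : ℝ) := by
  have hd0 : (d : ℝ) ≠ 0 := by positivity
  induction n generalizing I with
  | zero =>
    rcases I.eq_empty_or_nonempty with rfl | hI
    · simp
    · rw [Nat.choose_eq_zero_of_lt hI.card_pos]
      obtain ⟨i, hi⟩ := hI
      rw [Nat.cast_zero, mul_zero]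
      exact Finset.prod_eq_zero hi (by simp)
  | succ n ih =>
    rw [Function.iterate_succ_apply, latticeAvg_prod_sq hd, latticeAvg_iterate, map_add, map_smul,
      map_sum]
    simp only [← latticeAvg_iterate, Pi.add_apply, Pi.smul_apply, Finset.sum_apply, ih,
      smul_eq_mul]
    rw [Finset.sum_congr rfl fun i hi => by rw [Finset.card_erase_of_mem hi], Finset.sum_const,
      nsmul_eq_mul]
    rcases I.card with _ | m
    · simp
    · rw [Nat.choose_succ_succ, Nat.factorial_succ, Nat.add_sub_cancel]
      push_cast
      field_simp
      ring

theorem stmt_18 (d : ℕ) (hd : 1 ≤ d) (k : ℕ) (hk : k ≤ d)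
    (u : (Fin d → ℤ) → ℝ) (hu : ∀ x, u x = ∏ i : Fin k, ((x (Fin.castLE hk i) : ℝ))) :
    (∀ x, latticeLap d u x = 0) ∧
    ∀ n : ℕ, growthQ d u n = ((k.factorial : ℝ) / (d : ℝ) ^ k) * (n.choose k : ℝ) := by
  let I : Finset (Fin d) := Finset.univ.map (Fin.castLEEmb hk)
  have hI : I.card = k := by simp [I]
  obtain rfl : u = fun x => ∏ i ∈ I, (x i : ℝ) := by
    ext x
    simp [hu, I]
  refine ⟨latticeLap_prod_coord hd I, fun n => ?_⟩
  simp only [growthQ, ← Finset.prod_pow]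
  rw [latticeAvg_iterate_prod_sq hd, hI]
end
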